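/- Let γ ∈ (−2,−1) and K > 0. Let h be a continuous function on B₁(0)∖{0} ⊆ ℂ with |h(ζ)| ≤ K·|ζ|^{γ}, and let w be a smooth function on B₁(0)∖{0} with sup_{B₁(0)∖{0}} |w| < ∞ satisfying ∂²w/∂ζ∂ζ̄ = h on B₁(0)∖{0}. Then there exists C > 0 (depending only on γ, K and sup|w|) such that |(∂w/∂ζ)(ζ₀)| ≤ C·|ζ₀|^{γ+1} for all ζ₀ ∈ B_{1/4}(0)∖{0}. -/

import Mathlib

noncomputable section

open Complex Metric

/-- Wirtinger derivative ∂f/∂ζ on ℂ. -/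
def wdz1 (f : ℂ → ℂ) (z : ℂ) : ℂ :=
  (1/2 : ℂ) * (fderiv ℝ f z 1 - Complex.I * fderiv ℝ f z Complex.I)

/-- Wirtinger derivative ∂f/∂ζ̄ on ℂ. -/
def wdzbar1 (f : ℂ → ℂ) (z : ℂ) : ℂ :=
  (1/2 : ℂ) * (fderiv ℝ f z 1 + Complex.I * fderiv ℝ f z Complex.I)

open MeasureTheory Set Filter Topology

/-- Cauchy–Pompeiu formula at the origin for compactly supported functions. -/
lemma integral_inv_mul_wdzbar1 {F : ℂ → ℂ} (hF : ContDiff ℝ 1 F) (hc : HasCompactSupport F) :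
    ∫ z, z⁻¹ * wdzbar1 F z = -Real.pi * F 0 := by
  set e : ℝ → ℂ := fun θ => (Real.cos θ : ℂ) + Real.sin θ * I with he
  have he_cont : Continuous e := by fun_prop
  have he_ne : ∀ θ, e θ * (Real.cos θ - Real.sin θ * I) = 1 := by
    intro θ
    have : (Real.cos θ : ℂ) ^ 2 + (Real.sin θ : ℂ) ^ 2 = 1 := by
      rw [add_comm]; exact_mod_cast Real.sin_sq_add_cos_sq θ
    simp only [he]; ring_nf; rw [I_sq]; linear_combination this
  have he_norm : ∀ θ, ‖e θ‖ = 1 := by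
    intro θ
    simp only [he]
    rw [ofReal_cos, ofReal_sin, ← Complex.exp_mul_I, Complex.norm_exp_ofReal_mul_I]
  have he_deriv : ∀ θ, HasDerivAt e (I * e θ) θ := by
    intro θ
    have h1 := (Real.hasDerivAt_cos θ).ofReal_comp
    have h2 := (Real.hasDerivAt_sin θ).ofReal_comp
    have := h1.add (h2.mul_const I)
    refine this.congr_deriv ?_
    simp only [he]; push_cast; ring_nf; rw [I_sq]; ring
  have hdF : Continuous (fderiv ℝ F) := hF.continuous_fderiv one_ne_zero
  have hFd : Differentiable ℝ F := hF.differentiable one_ne_zero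
  set A : ℝ × ℝ → ℂ := fun p => fderiv ℝ F (p.1 * e p.2) (e p.2) with hA
  set B : ℝ × ℝ → ℂ := fun p => fderiv ℝ F (p.1 * e p.2) (I * e p.2) with hB
  have hAc : Continuous A := by
    apply Continuous.clm_apply <;> fun_prop
  have hBc : Continuous B := by
    apply Continuous.clm_apply <;> fun_prop
  obtain ⟨R, hR0, hR⟩ : ∃ R > 0, ∀ z : ℂ, R < ‖z‖ → fderiv ℝ F z = 0 := by
    obtain ⟨R, hR⟩ := (hc.fderiv (𝕜 := ℝ)).isCompact.isBounded.subset_closedBall 0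
    refine ⟨max R 1, by positivity, fun z hz => ?_⟩
    by_contra h
    have := hR (subset_tsupport _ (Function.mem_support.2 h))
    simp at this
    exact absurd (lt_of_le_of_lt (le_max_left _ _) hz) (not_lt.2 this)
  have hint : ∀ G : ℝ × ℝ → ℂ, Continuous G → (∀ p : ℝ × ℝ, R < p.1 → G p = 0) →
      IntegrableOn G (Ioi 0 ×ˢ Ioo (-Real.pi) Real.pi) (volume.prod volume) := by
    intro G hG h0
    have h1 : IntegrableOn G (Icc 0 R ×ˢ Icc (-Real.pi) Real.pi) (volume.prod volume) :=
      hG.continuousOn.integrableOn_compact (isCompact_Icc.prod isCompact_Icc)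
    refine h1.of_forall_sdiff_eq_zero (measurableSet_Ioi.prod measurableSet_Ioo) ?_
    rintro ⟨r, θ⟩ ⟨⟨h1, h2⟩, h3⟩
    apply h0
    by_contra h
    exact h3 ⟨⟨le_of_lt h1, not_lt.1 h⟩, Ioo_subset_Icc_self h2⟩
  have hzero : ∀ r θ : ℝ, R < r → fderiv ℝ F (r * e θ) = 0 := by
    intro r θ hr
    apply hR
    rw [norm_mul, he_norm, mul_one, norm_real, Real.norm_eq_abs]
    exact hr.trans_le (le_abs_self r)
  have hAi := hint A hAc (fun p hp => by simp [hA, hzero _ _ hp])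
  have hBi := hint B hBc (fun p hp => by simp [hB, hzero _ _ hp])
  have hAint : ∫ p in Ioi 0 ×ˢ Ioo (-Real.pi) Real.pi, A p ∂(volume.prod volume)
      = -(2 * Real.pi) * F 0 := by
    have hsw : ∀ θ : ℝ, ∫ r in Ioi (0:ℝ), A (r, θ) = - F 0 := by
      intro θ
      have hd : ∀ r : ℝ, HasDerivAt (fun r : ℝ => F (r * e θ)) (A (r, θ)) r := by
        intro r
        have h1 : HasDerivAt (fun r : ℝ => (r : ℂ) * e θ) (1 * e θ) r :=
          (Complex.ofRealCLM.hasDerivAt (x := r)).mul_const (e θ)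
        rw [one_mul] at h1
        exact (hFd _).hasFDerivAt.comp_hasDerivAt r h1
      have h2 := HasCompactSupport.integral_Ioi_deriv_eq (f := fun r : ℝ => F (r * e θ))
        (hF.comp (Complex.ofRealCLM.contDiff.mul contDiff_const)) ?_ 0
      · rw [show (fun r => A (r, θ)) = deriv (fun r : ℝ => F (r * e θ)) from
          funext fun r => (hd r).deriv.symm, h2]
        simp
      · refine hc.comp_isClosedEmbedding (g := fun r : ℝ => (r : ℂ) * e θ) ?_
        refine (Isometry.of_dist_eq fun x y => ?_).isClosedEmbedding
        rw [dist_eq_norm, ← sub_mul, norm_mul, he_norm, mul_one, ← ofReal_sub, norm_real,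
          dist_eq_norm]
    rw [← Measure.prod_restrict, integral_prod_symm _ (by rwa [Measure.prod_restrict])]
    simp_rw [hsw]
    rw [setIntegral_const, Real.volume_real_Ioo_of_le (by linarith [Real.pi_pos]), real_smul]
    push_cast; ring
  have hBint : ∫ p in Ioi 0 ×ˢ Ioo (-Real.pi) Real.pi, B p ∂(volume.prod volume) = 0 := by
    rw [setIntegral_prod _ hBi]
    refine setIntegral_eq_zero_of_forall_eq_zero fun r hr => ?_
    have hr : 0 < r := hr
    rw [← integral_Ioc_eq_integral_Ioo, ← intervalIntegral.integral_of_le (by linarith [Real.pi_pos])]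
    have hd : ∀ θ : ℝ, HasDerivAt (fun θ : ℝ => (r : ℂ)⁻¹ * F (r * e θ)) (B (r, θ)) θ := by
      intro θ
      have h1 : HasDerivAt (fun θ : ℝ => (r : ℂ) * e θ) (r * (I * e θ)) θ :=
          (he_deriv θ).const_mul (r : ℂ)
      have h2 := ((hFd _).hasFDerivAt.comp_hasDerivAt θ h1).const_mul (r : ℂ)⁻¹
      refine h2.congr_deriv ?_
      rw [← real_smul (x := r) (z := I * e θ), map_smul, real_smul, ← mul_assoc, inv_mul_cancel₀ (by exact_mod_cast hr.ne'), one_mul]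
    rw [intervalIntegral.integral_eq_sub_of_hasDerivAt (fun θ _ => hd θ)
      (Continuous.intervalIntegrable (by fun_prop) _ _)]
    simp [he]
  rw [← Complex.integral_comp_polarCoord_symm, polarCoord_target]
  have : ∀ p ∈ Ioi (0:ℝ) ×ˢ Ioo (-Real.pi) Real.pi,
      p.1 • ((Complex.polarCoord.symm p)⁻¹ * wdzbar1 F (Complex.polarCoord.symm p))
        = (1/2 : ℂ) * A p + (I / 2) * B p := by
    rintro ⟨r, θ⟩ ⟨hr, -⟩
    have hr : (r : ℂ) ≠ 0 := by exact_mod_cast (ne_of_gt hr)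
    rw [Complex.polarCoord_symm_apply]
    change r • ((r * e θ)⁻¹ * _) = _
    simp only [hA, hB, wdzbar1]
    set L := fderiv ℝ F (r * e θ) with hL
    have h1 : L (e θ) = Real.cos θ * L 1 + Real.sin θ * L I := by
      rw [show e θ = Real.cos θ • (1:ℂ) + Real.sin θ • I by simp [he], map_add, map_smul, map_smul]
      simp
    have h2 : L (I * e θ) = -Real.sin θ * L 1 + Real.cos θ * L I := by
      rw [show I * e θ = (-Real.sin θ) • (1:ℂ) + Real.cos θ • I by
        simp [he]; ring_nf; rw [I_sq]; ring, map_add, map_smul, map_smul]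
      simp
    rw [h1, h2, mul_inv, show (e θ)⁻¹ = Real.cos θ - Real.sin θ * I from
      inv_eq_of_mul_eq_one_right (he_ne θ)]
    rw [real_smul]
    field_simp
    ring_nf
    rw [I_sq]
    ring
  rw [setIntegral_congr_fun (measurableSet_Ioi.prod measurableSet_Ioo) this]
  rw [Measure.volume_eq_prod]
  rw [integral_add (hAi.const_mul _) (hBi.const_mul _), integral_const_mul, integral_const_mul,
    hAint, hBint]
  ring

/-- Cauchy–Pompeiu formula for compactly supported functions. -/
lemma integral_sub_inv_mul_wdzbar1 {F : ℂ → ℂ} (hF : ContDiff ℝ 1 F) (hc : HasCompactSupport F)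
    (c : ℂ) : ∫ z, (z - c)⁻¹ * wdzbar1 F z = -Real.pi * F c := by
  have h := integral_inv_mul_wdzbar1 (F := fun z => F (z + c)) (by fun_prop)
    (hc.comp_homeomorph (Homeomorph.addRight c))
  rw [zero_add, ← integral_sub_right_eq_self _ c] at h
  rw [← h]
  congr 1 with z
  simp [wdzbar1, fderiv_comp_add_right]

lemma contDiff_mul_of_tsupport_subset {n : WithTop ℕ∞} {U : Set ℂ} (hU : IsOpen U) {a g : ℂ → ℂ}
    (ha : ContDiff ℝ n a) (hs : tsupport a ⊆ U) (hg : ContDiffOn ℝ n g U) :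
    ContDiff ℝ n (fun z => a z * g z) := by
  rw [contDiff_iff_contDiffAt]
  intro z
  by_cases hz : z ∈ U
  · exact ha.contDiffAt.mul (hg.contDiffAt (hU.mem_nhds hz))
  · have h0 : a =ᶠ[𝓝 z] 0 := notMem_tsupport_iff_eventuallyEq.1 fun h => hz (hs h)
    refine (contDiffAt_const (c := (0 : ℂ))).congr_of_eventuallyEq ?_
    filter_upwards [h0] with x hx
    simp [hx]

lemma fderiv_mul_apply_of_tsupport_subset {U : Set ℂ} (hU : IsOpen U) {a g : ℂ → ℂ}
    (ha : Differentiable ℝ a) (hs : tsupport a ⊆ U) (hg : DifferentiableOn ℝ g U) (z v : ℂ) :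
    fderiv ℝ (fun z => a z * g z) z v = fderiv ℝ a z v * g z + a z * fderiv ℝ g z v := by
  by_cases hz : z ∈ U
  · rw [fderiv_fun_mul (ha z) (hg.differentiableAt (hU.mem_nhds hz))]
    simp
    ring
  · have h0 : a =ᶠ[𝓝 z] 0 := notMem_tsupport_iff_eventuallyEq.1 fun h => hz (hs h)
    have h1 : (fun z => a z * g z) =ᶠ[𝓝 z] 0 := by
      filter_upwards [h0] with x hx
      simp [hx]
    rw [h1.fderiv_eq, h0.fderiv_eq, h0.eq_of_nhds]
    simp

lemma integral_wdz1_eq_zero {T : ℂ → ℂ} (hT : ContDiff ℝ 1 T) (hc : HasCompactSupport T) :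
    ∫ z, wdz1 T z = 0 := by
  have hi : ∀ v : ℂ, Integrable fun z => fderiv ℝ T z v := fun v =>
    ((hT.continuous_fderiv one_ne_zero).clm_apply continuous_const).integrable_of_hasCompactSupport
      (hc.fderiv_apply (𝕜 := ℝ) v)
  have h0 : ∀ v : ℂ, ∫ z, fderiv ℝ T z v = 0 := by
    intro v
    have := integral_mul_fderiv_eq_neg_fderiv_mul_of_integrable (μ := volume) (𝕜 := ℂ)
      (f := fun _ : ℂ => (1 : ℂ)) (g := T) (v := v) (by simp) (by simpa using hi v)
      (by simpa using hT.continuous.integrable_of_hasCompactSupport hc)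
      (fun x _ => differentiableAt_const _) (fun x _ => hT.differentiable one_ne_zero x)
    simpa using this
  simp only [wdz1]
  rw [integral_const_mul, integral_sub (hi 1) ((hi I).const_mul I), integral_const_mul, h0, h0]
  simp

lemma integrable_inv_mul {f : ℂ → ℂ} (hf : Continuous f) (hc : HasCompactSupport f) (c : ℂ) :
    Integrable fun z => (z - c)⁻¹ * f z := by
  suffices h : ∀ f : ℂ → ℂ, Continuous f → HasCompactSupport f →
      Integrable fun z => z⁻¹ * f z by
    have := (h (fun z => f (z + c)) (by fun_prop)
      (hc.comp_homeomorph (Homeomorph.addRight c))).comp_sub_right c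
    simpa using this
  clear hf hc f
  intro f hf hc
  obtain ⟨C, hC⟩ := hf.bounded_above_of_compact_support hc
  obtain ⟨R, hR⟩ := hc.isCompact.isBounded.subset_closedBall 0
  have hrad : Integrable fun z : ℂ => (Iic R).indicator (fun y : ℝ => C * y⁻¹) ‖z‖ := by
    rw [integrable_fun_norm_addHaar (volume : Measure ℂ) (f := (Iic R).indicator fun y : ℝ => C * y⁻¹)]
    have h1 : IntegrableOn ((Iic R).indicator fun _ : ℝ => C) (Ioi 0) := by
      rw [IntegrableOn, integrable_indicator_iff measurableSet_Iic, IntegrableOn,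
        Measure.restrict_restrict measurableSet_Iic, inter_comm, Ioi_inter_Iic]
      exact integrableOn_const (by simp)
    refine h1.congr_fun (fun y hy => ?_) measurableSet_Ioi
    have hy : y ≠ 0 := ne_of_gt hy
    by_cases h : y ∈ Iic R
    · simp [h]
      field_simp
    · simp [h]
  refine hrad.mono' (by fun_prop) (ae_of_all _ fun z => ?_)
  by_cases hz : ‖z‖ ≤ R
  · rw [indicator_of_mem (mem_Iic.2 hz), norm_mul, norm_inv, mul_comm]
    gcongr
    exact hC z
  · have : f z = 0 := by
      by_contra h
      exact hz (by simpa using hR (subset_tsupport _ h))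
    rw [indicator_of_notMem (notMem_Iic.2 (not_le.1 hz)), this]
    simp

lemma ContDiffOn.wdz1 {U : Set ℂ} (hU : IsOpen U) {w : ℂ → ℂ} (hw : ContDiffOn ℝ (⊤ : ℕ∞) w U) :
    ContDiffOn ℝ (⊤ : ℕ∞) (wdz1 w) U := by
  have h : ContDiffOn ℝ (⊤ : ℕ∞) (fderiv ℝ w) U := hw.fderiv_of_isOpen hU (by simp)
  exact contDiffOn_const.mul ((h.clm_apply contDiffOn_const).sub
    (contDiffOn_const.mul (h.clm_apply contDiffOn_const)))

lemma ContDiffOn.wdzbar1 {U : Set ℂ} (hU : IsOpen U) {w : ℂ → ℂ}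
    (hw : ContDiffOn ℝ (⊤ : ℕ∞) w U) : ContDiffOn ℝ (⊤ : ℕ∞) (wdzbar1 w) U := by
  have h : ContDiffOn ℝ (⊤ : ℕ∞) (fderiv ℝ w) U := hw.fderiv_of_isOpen hU (by simp)
  exact contDiffOn_const.mul ((h.clm_apply contDiffOn_const).add
    (contDiffOn_const.mul (h.clm_apply contDiffOn_const)))

lemma wdzbar1_wdz1_comm {w : ℂ → ℂ} {z : ℂ} (hw : ContDiffAt ℝ (⊤ : ℕ∞) w z) :
    wdzbar1 (wdz1 w) z = wdz1 (wdzbar1 w) z := by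
  have hs : IsSymmSndFDerivAt ℝ w z := hw.isSymmSndFDerivAt (by
    simpa using WithTop.coe_le_coe.2 (le_top : (2 : ℕ∞) ≤ ⊤))
  have hd : DifferentiableAt ℝ (fderiv ℝ w) z :=
    (hw.fderiv_right (m := 1) (by norm_cast)).differentiableAt one_ne_zero
  have happ : ∀ u : ℂ, HasFDerivAt (fun x => fderiv ℝ w x u)
      ((fderiv ℝ (fderiv ℝ w) z).flip u) z := fun u => by
    simpa using hd.hasFDerivAt.clm_apply (hasFDerivAt_const u z)
  have h1 : ∀ v, fderiv ℝ (wdz1 w) z v = (1 / 2 : ℂ) *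
      (fderiv ℝ (fderiv ℝ w) z v 1 - I * fderiv ℝ (fderiv ℝ w) z v I) := fun v => by
    have : HasFDerivAt (wdz1 w) _ z := ((happ 1).sub ((happ I).const_mul I)).const_mul (1 / 2 : ℂ)
    rw [this.fderiv]
    simp
  have h2 : ∀ v, fderiv ℝ (wdzbar1 w) z v = (1 / 2 : ℂ) *
      (fderiv ℝ (fderiv ℝ w) z v 1 + I * fderiv ℝ (fderiv ℝ w) z v I) := fun v => by
    have : HasFDerivAt (wdzbar1 w) _ z :=
      ((happ 1).add ((happ I).const_mul I)).const_mul (1 / 2 : ℂ)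
    rw [this.fderiv]
    simp
    ring
  rw [wdzbar1, wdz1, h1, h1, h2, h2, hs.eq I 1]
  ring

lemma wdzbar1_eq_zero_of_notMem_tsupport {f : ℂ → ℂ} {z : ℂ} (hz : z ∉ tsupport f) :
    wdzbar1 f z = 0 := by
  simp [wdzbar1, (notMem_tsupport_iff_eventuallyEq.1 hz).fderiv_eq]

/-- Representation of `∂w` by testing `∂̄∂w` against a cut-off Cauchy kernel. -/
lemma pi_mul_wdz1_eq {U : Set ℂ} (hU : IsOpen U) {ψ w : ℂ → ℂ} {c : ℂ}
    (hψ : ContDiff ℝ (⊤ : ℕ∞) ψ) (hc : HasCompactSupport ψ) (hs : tsupport ψ ⊆ U)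
    (h1 : ψ =ᶠ[𝓝 c] 1) (hw : ContDiffOn ℝ (⊤ : ℕ∞) w U) :
    Real.pi * wdz1 w c = -(∫ z, (z - c)⁻¹ * (ψ z * wdzbar1 (wdz1 w) z)) +
      ∫ z, wdz1 (fun z => (z - c)⁻¹ * wdzbar1 ψ z) z * w z := by
  set a : ℂ → ℂ := fun z => (z - c)⁻¹ * wdzbar1 ψ z with ha
  have hψ' : ContDiff ℝ (⊤ : ℕ∞) (wdzbar1 ψ) :=
    contDiffOn_univ.1 (ContDiffOn.wdzbar1 isOpen_univ hψ.contDiffOn)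
  have hg := hw.wdz1 hU
  have hac : ContDiff ℝ (⊤ : ℕ∞) a := by
    rw [contDiff_iff_contDiffAt]
    intro z
    by_cases hz : z = c
    · subst hz
      refine (contDiffAt_const (c := (0 : ℂ))).congr_of_eventuallyEq ?_
      filter_upwards [h1.eventually_nhds] with x hx
      have hx : ψ =ᶠ[𝓝 x] fun _ => 1 := hx
      simp [ha, wdzbar1, hx.fderiv_eq]
    · exact ((contDiffAt_id.sub contDiffAt_const).inv (sub_ne_zero.2 hz)).mul hψ'.contDiffAt
  have hat : tsupport a ⊆ tsupport ψ := by
    refine closure_minimal (fun z hz => ?_) (isClosed_tsupport ψ)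
    by_contra h
    exact hz (by simp [ha, wdzbar1_eq_zero_of_notMem_tsupport h])
  have hacs : HasCompactSupport a := hc.of_isClosed_subset (isClosed_tsupport a) hat
  have hgd := hg.differentiableOn (by simp)
  have hwd := hw.differentiableOn (by simp)
  have e1 := integral_sub_inv_mul_wdzbar1 (F := fun z => ψ z * wdz1 w z)
    ((contDiff_mul_of_tsupport_subset hU hψ hs hg).of_le (by simp)) hc.mul_right c
  have e2 := integral_wdz1_eq_zero (T := fun z => a z * w z)
    ((contDiff_mul_of_tsupport_subset hU hac (hat.trans hs) hw).of_le (by simp)) hacs.mul_right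
  have p1 : ∀ z, (z - c)⁻¹ * wdzbar1 (fun z => ψ z * wdz1 w z) z
      = a z * wdz1 w z + (z - c)⁻¹ * (ψ z * wdzbar1 (wdz1 w) z) := by
    intro z
    simp only [ha]
    rw [wdzbar1, wdzbar1, wdzbar1]
    simp only [fderiv_mul_apply_of_tsupport_subset hU (hψ.differentiable (by simp)) hs hgd]
    ring
  have p2 : ∀ z, wdz1 (fun z => a z * w z) z = a z * wdz1 w z + wdz1 a z * w z := by
    intro z
    rw [wdz1, wdz1, wdz1]
    simp only [fderiv_mul_apply_of_tsupport_subset hU (hac.differentiable (by simp))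
      (hat.trans hs) hwd]
    ring
  have i1 : Integrable fun z => a z * wdz1 w z :=
    (contDiff_mul_of_tsupport_subset hU hac (hat.trans hs) hg).continuous.integrable_of_hasCompactSupport
      hacs.mul_right
  have i2 : Integrable fun z => (z - c)⁻¹ * (ψ z * wdzbar1 (wdz1 w) z) :=
    integrable_inv_mul (contDiff_mul_of_tsupport_subset hU hψ hs (hg.wdzbar1 hU)).continuous
      hc.mul_right c
  have hac' : ContDiff ℝ (⊤ : ℕ∞) (wdz1 a) :=
    contDiffOn_univ.1 (ContDiffOn.wdz1 isOpen_univ hac.contDiffOn)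
  have hacs' : tsupport (wdz1 a) ⊆ tsupport a := by
    refine closure_minimal (fun z hz => ?_) (isClosed_tsupport a)
    by_contra h
    exact hz (by simp [wdz1, (notMem_tsupport_iff_eventuallyEq.1 h).fderiv_eq])
  have i3 : Integrable fun z => wdz1 a z * w z :=
    (contDiff_mul_of_tsupport_subset hU hac' (hacs'.trans (hat.trans hs))
      hw).continuous.integrable_of_hasCompactSupport
      (HasCompactSupport.mul_right (hacs.of_isClosed_subset (isClosed_tsupport _) hacs'))
  simp only [p1] at e1
  simp only [p2] at e2
  rw [integral_add i1 i2] at e1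
  rw [integral_add i1 i3] at e2
  rw [h1.eq_of_nhds, Pi.one_apply, one_mul] at e1
  linear_combination e1 - e2

lemma integrable_radial_rpow {γ : ℝ} (h2 : -2 < γ) (h1 : γ < -1) :
    Integrable fun z : ℂ => if ‖z‖ ≤ 1 then ‖z‖ ^ γ else ‖z‖ ^ (γ - 1) := by
  rw [integrable_fun_norm_addHaar (volume : Measure ℂ)
    (f := fun r : ℝ => if r ≤ 1 then r ^ γ else r ^ (γ - 1)), ← Ioc_union_Ioi_eq_Ioi zero_le_one]
  refine IntegrableOn.union ?_ ?_
  · have h : IntegrableOn (fun r : ℝ => r ^ (γ + 1)) (Ioc 0 1) := by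
      rw [integrableOn_Ioc_iff_integrableOn_Ioo]
      exact (intervalIntegral.integrableOn_Ioo_rpow_iff one_pos).2 (by linarith)
    refine h.congr_fun (fun r hr => ?_) measurableSet_Ioc
    simp [hr.2, Real.rpow_add_one hr.1.ne', mul_comm]
  · refine (integrableOn_Ioi_rpow_of_lt h1 one_pos).congr_fun (fun r hr => ?_) measurableSet_Ioi
    have hr0 : r ≠ 0 := (one_pos.trans hr).ne'
    simp [not_le.2 (mem_Ioi.1 hr), Real.rpow_sub_one hr0]
    field_simp

lemma rpow_mul_inv_le {γ X Y : ℝ} (h2 : -2 < γ) (h1 : γ < -1) (hX : 0 ≤ X) (hY : 0 ≤ Y)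
    (hXY : 1 ≤ X + Y) :
    X ^ γ * Y⁻¹ ≤ 4 * ((if X ≤ 1 then X ^ γ else X ^ (γ - 1)) +
      (if Y ≤ 1 then Y ^ γ else Y ^ (γ - 1))) := by
  have hpos : ∀ r : ℝ, 0 ≤ r → 0 ≤ if r ≤ 1 then r ^ γ else r ^ (γ - 1) := by
    intro r hr
    split_ifs <;> positivity
  have hX' := hpos X hX
  have hY' := hpos Y hY
  rcases hX.eq_or_lt with rfl | hX0
  · rw [Real.zero_rpow (by linarith), zero_mul]
    positivity
  rcases hY.eq_or_lt with rfl | hY0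
  · rw [inv_zero, mul_zero]
    positivity
  rcases le_total X Y with h | h
  · suffices X ^ γ * Y⁻¹ ≤ 2 * (if X ≤ 1 then X ^ γ else X ^ (γ - 1)) by linarith
    have hXγ : 0 < X ^ γ := by positivity
    split_ifs with hX1
    · have : Y⁻¹ ≤ 2 := by
        rw [inv_le_comm₀ hY0 two_pos]; linarith
      nlinarith
    · rw [Real.rpow_sub_one hX0.ne', div_eq_mul_inv]
      have : Y⁻¹ ≤ X⁻¹ := inv_anti₀ hX0 h
      have : 0 < X⁻¹ := by positivity
      nlinarith
  · suffices X ^ γ * Y⁻¹ ≤ 4 * (if Y ≤ 1 then Y ^ γ else Y ^ (γ - 1)) by linarith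
    split_ifs with hY1
    · have hX4 : X ^ γ ≤ 4 := by
        calc X ^ γ ≤ (1 / 2 : ℝ) ^ γ :=
              Real.rpow_le_rpow_of_nonpos (by norm_num) (by linarith) (by linarith)
          _ ≤ (1 / 2 : ℝ) ^ (-2 : ℝ) :=
              Real.rpow_le_rpow_of_exponent_ge (by norm_num) (by norm_num) h2.le
          _ = 4 := by rw [Real.rpow_neg (by norm_num)]; norm_num
      have : Y⁻¹ ≤ Y ^ γ := by
        rw [← Real.rpow_neg_one]
        exact Real.rpow_le_rpow_of_exponent_ge hY0 hY1 h1.le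
      gcongr
    · have : X ^ γ ≤ Y ^ γ := Real.rpow_le_rpow_of_nonpos hY0 h (by linarith)
      rw [Real.rpow_sub_one hY0.ne', div_eq_mul_inv]
      have : 0 < Y⁻¹ := by positivity
      have : 0 < Y ^ γ := by positivity
      nlinarith [mul_pos ‹0 < Y ^ γ› ‹0 < Y⁻¹›]

/-- The Cauchy transform of `‖z‖ ^ γ`, for `-2 < γ < -1`, is of order `‖c‖ ^ (γ + 1)`. -/
lemma exists_integral_rpow_mul_inv_le {γ : ℝ} (h2 : -2 < γ) (h1 : γ < -1) :
    ∃ C : ℝ, 0 ≤ C ∧ ∀ c : ℂ, c ≠ 0 → Integrable (fun z : ℂ => ‖z‖ ^ γ * ‖z - c‖⁻¹) ∧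
      ∫ z : ℂ, ‖z‖ ^ γ * ‖z - c‖⁻¹ ≤ C * ‖c‖ ^ (γ + 1) := by
  set φ : ℝ → ℝ := fun r => if r ≤ 1 then r ^ γ else r ^ (γ - 1) with hφ
  have hφ0 : ∀ r : ℝ, 0 ≤ r → 0 ≤ φ r := by
    intro r hr
    simp only [hφ]
    split_ifs <;> positivity
  have hφi : Integrable fun z : ℂ => φ ‖z‖ := integrable_radial_rpow h2 h1
  refine ⟨8 * ∫ z : ℂ, φ ‖z‖, mul_nonneg (by norm_num)
    (integral_nonneg fun z => hφ0 _ (norm_nonneg z)), fun c hc => ?_⟩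
  have hρ : 0 < ‖c‖ := norm_pos_iff.2 hc
  set ρ := ‖c‖
  have hsc : ∀ z : ℂ, φ (‖z‖ / ρ) = φ ‖ρ⁻¹ • z‖ := fun z => by
    rw [norm_smul, norm_inv, Real.norm_of_nonneg hρ.le, div_eq_inv_mul]
  have i1 : Integrable fun z : ℂ => φ (‖z‖ / ρ) := by
    simp_rw [hsc]
    exact (integrable_comp_smul_iff volume (fun z : ℂ => φ ‖z‖) (inv_ne_zero hρ.ne')).2 hφi
  have i2 : Integrable fun z : ℂ => φ (‖z - c‖ / ρ) := i1.comp_sub_right c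
  have e1 : ∫ z : ℂ, φ (‖z‖ / ρ) = ρ ^ 2 * ∫ z : ℂ, φ ‖z‖ := by
    simp_rw [hsc]
    rw [Measure.integral_comp_smul volume (fun z : ℂ => φ ‖z‖)]
    simp
  have e2 : ∫ z : ℂ, φ (‖z - c‖ / ρ) = ρ ^ 2 * ∫ z : ℂ, φ ‖z‖ := by
    rw [← e1]
    exact integral_sub_right_eq_self (fun z : ℂ => φ (‖z‖ / ρ)) c
  have hle : ∀ z : ℂ, ‖z‖ ^ γ * ‖z - c‖⁻¹ ≤
      ρ ^ (γ - 1) * (4 * (φ (‖z‖ / ρ) + φ (‖z - c‖ / ρ))) := by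
    intro z
    have h := rpow_mul_inv_le (X := ‖z‖ / ρ) (Y := ‖z - c‖ / ρ) h2 h1 (by positivity)
      (by positivity) (by
        rw [← add_div, le_div_iff₀ hρ, one_mul]
        calc ρ = ‖z - (z - c)‖ := by simp [ρ]
          _ ≤ _ := norm_sub_le _ _)
    calc ‖z‖ ^ γ * ‖z - c‖⁻¹ = ρ ^ (γ - 1) * ((‖z‖ / ρ) ^ γ * (‖z - c‖ / ρ)⁻¹) := by
          rw [Real.div_rpow (norm_nonneg _) hρ.le, Real.rpow_sub_one hρ.ne']
          have : ρ ^ γ ≠ 0 := by positivity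
          field_simp
      _ ≤ _ := by gcongr
  have iD : Integrable fun z : ℂ => ρ ^ (γ - 1) * (4 * (φ (‖z‖ / ρ) + φ (‖z - c‖ / ρ))) :=
    ((i1.add i2).const_mul 4).const_mul _
  have iK : Integrable fun z : ℂ => ‖z‖ ^ γ * ‖z - c‖⁻¹ := by
    refine iD.mono' (by fun_prop) (ae_of_all _ fun z => ?_)
    rw [Real.norm_of_nonneg (by positivity)]
    exact hle z
  refine ⟨iK, (integral_mono iK iD hle).trans_eq ?_⟩
  rw [integral_const_mul, integral_const_mul, integral_add i1 i2, e1, e2]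
  rw [show γ + 1 = γ - 1 + 2 by ring, Real.rpow_add hρ, Real.rpow_two]
  ring

lemma integral_annulus {a b : ℝ} (ha : 0 < a) (hab : a ≤ b) :
    Integrable (fun z : ℂ => (Icc a b).indicator (fun r : ℝ => (r ^ 2)⁻¹) ‖z‖) ∧
      ∫ z : ℂ, (Icc a b).indicator (fun r : ℝ => (r ^ 2)⁻¹) ‖z‖ =
        2 * Real.pi * Real.log (b / a) := by
  have hpt : EqOn ((Icc a b).indicator fun r : ℝ => r⁻¹)
      (fun y => y ^ (Module.finrank ℝ ℂ - 1) • (Icc a b).indicator (fun r : ℝ => (r ^ 2)⁻¹) y)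
      (Ioi 0) := by
    intro y hy
    have hy : y ≠ 0 := ne_of_gt hy
    by_cases h : y ∈ Icc a b
    · simp only [indicator_of_mem h, finrank_real_complex, smul_eq_mul]
      field_simp
      simp
    · simp [indicator_of_notMem h]
  have hsub : Icc a b ∩ Ioi 0 = Icc a b :=
    inter_eq_left.2 fun y hy => ha.trans_le hy.1
  constructor
  · rw [integrable_fun_norm_addHaar (volume : Measure ℂ)
      (f := (Icc a b).indicator fun r : ℝ => (r ^ 2)⁻¹)]
    refine IntegrableOn.congr_fun ?_ hpt measurableSet_Ioi
    rw [IntegrableOn, integrable_indicator_iff measurableSet_Icc, IntegrableOn,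
      Measure.restrict_restrict measurableSet_Icc, hsub]
    exact (continuousOn_inv₀.mono fun y hy => (ha.trans_le hy.1).ne').integrableOn_compact
      isCompact_Icc
  · rw [integral_fun_norm_addHaar (volume : Measure ℂ)
      (f := (Icc a b).indicator fun r : ℝ => (r ^ 2)⁻¹),
      ← setIntegral_congr_fun measurableSet_Ioi hpt, integral_indicator measurableSet_Icc,
      Measure.restrict_restrict measurableSet_Icc, hsub, integral_Icc_eq_integral_Ioc,
      ← intervalIntegral.integral_of_le hab, integral_inv_of_pos ha (ha.trans_le hab)]
    simp [Measure.real, Complex.volume_ball, mul_assoc]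

lemma exists_smooth_step : ∃ s : ℝ → ℝ, ContDiff ℝ (⊤ : ℕ∞) s ∧ (∀ t ≤ 0, s t = 0) ∧
    (∀ t, 1 ≤ t → s t = 1) ∧ (∀ t, s t ∈ Icc (0 : ℝ) 1) ∧
    ∃ C : ℝ, 0 < C ∧ ∀ t, |deriv s t| ≤ C ∧ |deriv (deriv s) t| ≤ C := by
  have hs : ContDiff ℝ (⊤ : ℕ∞) Real.smoothTransition := Real.smoothTransition.contDiff
  have hd : ContDiff ℝ (⊤ : ℕ∞) (deriv Real.smoothTransition) :=
    (contDiff_infty_iff_deriv.1 hs).2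
  have hdd : ContDiff ℝ (⊤ : ℕ∞) (deriv (deriv Real.smoothTransition)) :=
    (contDiff_infty_iff_deriv.1 hd).2
  have hc : HasCompactSupport (deriv Real.smoothTransition) := by
    refine HasCompactSupport.intro (isCompact_Icc (a := (0 : ℝ)) (b := 1)) fun t ht => ?_
    rcases not_and_or.1 ht with h | h
    · have : Real.smoothTransition =ᶠ[𝓝 t] fun _ => 0 := by
        filter_upwards [Iio_mem_nhds (not_le.1 h)] with x hx
        exact Real.smoothTransition.zero_of_nonpos hx.le
      simp [this.deriv_eq]
    · have : Real.smoothTransition =ᶠ[𝓝 t] fun _ => 1 := by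
        filter_upwards [Ioi_mem_nhds (not_le.1 h)] with x hx
        exact Real.smoothTransition.one_of_one_le (le_of_lt hx)
      simp [this.deriv_eq]
  obtain ⟨C₁, h₁⟩ := hd.continuous.bounded_above_of_compact_support hc
  obtain ⟨C₂, h₂⟩ := hdd.continuous.bounded_above_of_compact_support hc.deriv
  exact ⟨_, hs, fun t => Real.smoothTransition.zero_of_nonpos,
    fun t => Real.smoothTransition.one_of_one_le,
    fun t => ⟨Real.smoothTransition.nonneg t, Real.smoothTransition.le_one t⟩,
    max 1 (max C₁ C₂), by positivity, fun t =>
      ⟨(h₁ t).trans ((le_max_left _ _).trans (le_max_right _ _)),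
        (h₂ t).trans ((le_max_right _ _).trans (le_max_right _ _))⟩⟩

lemma hasFDerivAt_comp_log_norm {f : ℝ → ℝ} (hf : Differentiable ℝ f) {z : ℂ} (hz : z ≠ 0) :
    ∃ L : ℂ →L[ℝ] ℂ, HasFDerivAt (fun z : ℂ => (f (Real.log ‖z‖) : ℂ)) L z ∧
      L 1 = deriv f (Real.log ‖z‖) * (z.re / ‖z‖ ^ 2) ∧
      L I = deriv f (Real.log ‖z‖) * (z.im / ‖z‖ ^ 2) := by
  have hn : (‖z‖ : ℂ) ≠ 0 := by exact_mod_cast norm_ne_zero_iff.2 hz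
  have h1 : HasFDerivAt (fun z : ℂ => ‖z‖ ^ 2) (2 • innerSL ℝ z) z :=
    (hasStrictFDerivAt_norm_sq z).hasFDerivAt
  have h2 := h1.log (by positivity)
  have h3 : HasFDerivAt (fun z : ℂ => Real.log ‖z‖)
      ((1 / 2 : ℝ) • ((‖z‖ ^ 2)⁻¹ • (2 • innerSL ℝ z))) z := by
    refine (h2.const_mul (1 / 2 : ℝ)).congr_of_eventuallyEq (Eventually.of_forall fun x => ?_)
    simp [Real.log_pow]
  have h4 := (hf (Real.log ‖z‖)).hasDerivAt.comp_hasFDerivAt z h3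
  have h5 := Complex.ofRealCLM.hasFDerivAt.comp z h4
  refine ⟨_, h5, ?_, ?_⟩
  · simp [Complex.inner]
    field_simp
    simp
  · simp [Complex.inner]
    field_simp
    simp

lemma wdzbar1_comp_log_norm {f : ℝ → ℝ} (hf : Differentiable ℝ f) {z : ℂ} (hz : z ≠ 0) :
    wdzbar1 (fun z : ℂ => (f (Real.log ‖z‖) : ℂ)) z =
      deriv f (Real.log ‖z‖) * (2 * (starRingEnd ℂ) z)⁻¹ := by
  obtain ⟨L, hL, h1, hI⟩ := hasFDerivAt_comp_log_norm hf hz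
  have hn : (starRingEnd ℂ) z ≠ 0 := by simpa using hz
  rw [wdzbar1, hL.fderiv, h1, hI, ← Complex.mul_conj' z]
  have : z = z.re + z.im * I := (re_add_im z).symm
  field_simp
  linear_combination (-deriv f (Real.log ‖z‖) : ℂ) * this

lemma wdz1_comp_log_norm {f : ℝ → ℝ} (hf : Differentiable ℝ f) {z : ℂ} (hz : z ≠ 0) :
    wdz1 (fun z : ℂ => (f (Real.log ‖z‖) : ℂ)) z = deriv f (Real.log ‖z‖) * (2 * z)⁻¹ := by
  obtain ⟨L, hL, h1, hI⟩ := hasFDerivAt_comp_log_norm hf hz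
  have hn : (starRingEnd ℂ) z ≠ 0 := by simpa using hz
  rw [wdz1, hL.fderiv, h1, hI, ← Complex.mul_conj' z]
  have : (starRingEnd ℂ) z = z.re - z.im * I := by
    apply Complex.ext <;> simp
  field_simp
  linear_combination (-deriv f (Real.log ‖z‖) : ℂ) * this

lemma wdz1_mul {a b : ℂ → ℂ} {z : ℂ} (ha : DifferentiableAt ℝ a z) (hb : DifferentiableAt ℝ b z) :
    wdz1 (fun z => a z * b z) z = wdz1 a z * b z + a z * wdz1 b z := by
  simp only [wdz1]
  rw [fderiv_fun_mul ha hb]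
  simp
  ring

lemma HasDerivAt.wdz1_eq {a : ℂ → ℂ} {a' z : ℂ} (ha : HasDerivAt a a' z) : wdz1 a z = a' := by
  rw [wdz1, (ha.hasFDerivAt.restrictScalars ℝ).fderiv]
  simp
  linear_combination -(1 / 2) * a' * I_sq

lemma wdz1_comp_conj_eq_zero {a : ℂ → ℂ} {z : ℂ}
    (ha : DifferentiableAt ℂ a ((starRingEnd ℂ) z)) :
    wdz1 (fun z => a ((starRingEnd ℂ) z)) z = 0 := by
  have h := (ha.hasDerivAt.hasFDerivAt.restrictScalars ℝ).comp z
    (Complex.conjCLE : ℂ →L[ℝ] ℂ).hasFDerivAt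
  have h' : HasFDerivAt (fun z => a ((starRingEnd ℂ) z)) _ z := h
  rw [wdz1, h'.fderiv]
  simp
  linear_combination (deriv a ((starRingEnd ℂ) z)) * I_sq

lemma norm_wdz1_inv_mul_wdzbar1_le {f : ℝ → ℝ} (hf : ContDiff ℝ (⊤ : ℕ∞) f) {z c : ℂ}
    (hz : z ≠ 0) (hzc : z ≠ c) :
    ‖wdz1 (fun z => (z - c)⁻¹ * wdzbar1 (fun z : ℂ => (f (Real.log ‖z‖) : ℂ)) z) z‖ ≤
      |deriv (deriv f) (Real.log ‖z‖)| * (4 * ‖z‖ ^ 2 * ‖z - c‖)⁻¹ +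
        |deriv f (Real.log ‖z‖)| * (2 * ‖z‖ * ‖z - c‖ ^ 2)⁻¹ := by
  have hd : ContDiff ℝ (⊤ : ℕ∞) (deriv f) := (contDiff_infty_iff_deriv.1 hf).2
  have hzc' : z - c ≠ 0 := sub_ne_zero.2 hzc
  have hcz : (starRingEnd ℂ) z ≠ 0 := by simpa using hz
  have heq : (fun z => (z - c)⁻¹ * wdzbar1 (fun z : ℂ => (f (Real.log ‖z‖) : ℂ)) z) =ᶠ[𝓝 z]
      fun z => (z - c)⁻¹ * (((deriv f (Real.log ‖z‖) : ℝ) : ℂ) * (2 * (starRingEnd ℂ) z)⁻¹) := by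
    filter_upwards [isOpen_ne.mem_nhds hz] with x hx
    rw [wdzbar1_comp_log_norm (hf.differentiable (by simp)) hx]
  have h1 : HasDerivAt (fun z : ℂ => (z - c)⁻¹) (-1 / (z - c) ^ 2) z :=
    ((hasDerivAt_id z).sub_const c).inv hzc'
  obtain ⟨L, hL, -, -⟩ := hasFDerivAt_comp_log_norm (hd.differentiable (by simp)) hz
  have h3 : DifferentiableAt ℂ (fun z : ℂ => (2 * z)⁻¹) ((starRingEnd ℂ) z) :=
    (differentiableAt_id.const_mul 2).inv (mul_ne_zero two_ne_zero hcz)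
  have h3' : DifferentiableAt ℝ (fun z : ℂ => (2 * (starRingEnd ℂ) z)⁻¹) z :=
    (h3.restrictScalars ℝ).comp z (Complex.conjCLE : ℂ →L[ℝ] ℂ).differentiableAt
  have h4 : DifferentiableAt ℝ (fun z : ℂ => ((deriv f (Real.log ‖z‖) : ℝ) : ℂ) *
      (2 * (starRingEnd ℂ) z)⁻¹) z := hL.differentiableAt.mul h3'
  have key : wdz1 (fun z => (z - c)⁻¹ * wdzbar1 (fun z : ℂ => (f (Real.log ‖z‖) : ℂ)) z) z =
      deriv (deriv f) (Real.log ‖z‖) * (4 * (z * (starRingEnd ℂ) z) * (z - c))⁻¹ -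
        deriv f (Real.log ‖z‖) * (2 * (starRingEnd ℂ) z * (z - c) ^ 2)⁻¹ := by
    rw [wdz1, heq.fderiv_eq, ← wdz1, wdz1_mul (h1.differentiableAt.restrictScalars ℝ) h4,
      wdz1_mul hL.differentiableAt h3', h1.wdz1_eq,
      wdz1_comp_log_norm (hd.differentiable (by simp)) hz, wdz1_comp_conj_eq_zero h3]
    field_simp
    ring
  rw [key]
  refine (norm_sub_le _ _).trans_eq ?_
  simp only [norm_mul, norm_inv, norm_pow, norm_real, norm_conj, Complex.norm_ofNat,
    Real.norm_eq_abs]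
  ring

lemma contDiff_comp_log_norm {f : ℝ → ℝ} {L : ℝ} (hf : ContDiff ℝ (⊤ : ℕ∞) f)
    (h0 : f 0 = 0) (hL : ∀ t ≤ -L, f t = 0) :
    ContDiff ℝ (⊤ : ℕ∞) fun z : ℂ => (f (Real.log ‖z‖) : ℂ) := by
  rw [contDiff_iff_contDiffAt]
  intro z
  by_cases hz : z = 0
  · subst hz
    refine (contDiffAt_const (c := (0 : ℂ))).congr_of_eventuallyEq ?_
    filter_upwards [ball_mem_nhds (0 : ℂ) (Real.exp_pos (-L))] with x hx
    by_cases hx0 : x = 0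
    · simp [hx0, h0]
    · rw [hL, ofReal_zero]
      rw [Real.log_le_iff_le_exp (norm_pos_iff.2 hx0)]
      exact le_of_lt (by simpa using hx)
  · exact Complex.ofRealCLM.contDiff.contDiffAt.comp z (hf.contDiffAt.comp z
      ((contDiffAt_norm ℝ hz).log (norm_ne_zero_iff.2 hz)))

lemma tsupport_comp_log_norm_subset {f : ℝ → ℝ} {L l : ℝ} (hl : 0 ≤ l)
    (hL : ∀ t ≤ -L, f t = 0) (hl' : ∀ t, -l ≤ t → f t = 0) :
    tsupport (fun z : ℂ => (f (Real.log ‖z‖) : ℂ)) ⊆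
      {z : ℂ | ‖z‖ ∈ Icc (Real.exp (-L)) (Real.exp (-l))} := by
  refine closure_minimal (fun z hz => ?_) (isClosed_Icc.preimage continuous_norm)
  have hz0 : z ≠ 0 := by
    rintro rfl
    exact hz (by simp [hl' 0 (by linarith)])
  have hpos := norm_pos_iff.2 hz0
  refine ⟨?_, ?_⟩ <;> by_contra h <;> rw [not_le] at h <;> apply hz
  · simp [hL _ ((Real.log_le_iff_le_exp hpos).2 h.le)]
  · simp [hl' _ ((Real.le_log_iff_exp_le hpos).2 h.le)]

/-- Equal to `1` on `[-n, -1]` and to `0` outside `[-2n, -1/2]`, when `s` is a smooth step. -/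
def logCutoff (s : ℝ → ℝ) (n : ℝ) (t : ℝ) : ℝ := s (2 + n⁻¹ * t) - s (2 + 2 * t)

lemma deriv_logCutoff {s : ℝ → ℝ} (hs : Differentiable ℝ s) (n : ℝ) :
    deriv (logCutoff s n) = fun t => n⁻¹ * deriv s (2 + n⁻¹ * t) - 2 * deriv s (2 + 2 * t) := by
  have h : ∀ k t : ℝ, HasDerivAt (fun t => s (2 + k * t)) (k * deriv s (2 + k * t)) t := by
    intro k t
    have h1 : HasDerivAt (fun t : ℝ => 2 + k * t) (k * 1) t :=
      ((hasDerivAt_id t).const_mul k).const_add 2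
    exact ((hs _).hasDerivAt.comp t h1).congr_deriv (by ring)
  ext t
  exact ((h n⁻¹ t).sub (h 2 t)).deriv

lemma deriv_deriv_logCutoff {s : ℝ → ℝ} (hs : Differentiable ℝ s)
    (hs' : Differentiable ℝ (deriv s)) (n : ℝ) :
    deriv (deriv (logCutoff s n)) =
      fun t => n⁻¹ ^ 2 * deriv (deriv s) (2 + n⁻¹ * t) - 4 * deriv (deriv s) (2 + 2 * t) := by
  have h : ∀ k t : ℝ, HasDerivAt (fun t => k * deriv s (2 + k * t))
      (k ^ 2 * deriv (deriv s) (2 + k * t)) t := by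
    intro k t
    have h1 : HasDerivAt (fun t : ℝ => 2 + k * t) (k * 1) t :=
      ((hasDerivAt_id t).const_mul k).const_add 2
    exact (((hs' _).hasDerivAt.comp t h1).const_mul k).congr_deriv (by ring)
  rw [deriv_logCutoff hs]
  ext t
  refine ((h n⁻¹ t).sub (h 2 t)).deriv.trans ?_
  norm_num

lemma deriv_eq_zero_of_step {s : ℝ → ℝ} (hs0 : ∀ t ≤ 0, s t = 0) (hs1 : ∀ t, 1 ≤ t → s t = 1)
    {t : ℝ} (ht : t < 0 ∨ 1 < t) : deriv s t = 0 ∧ deriv (deriv s) t = 0 := by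
  have : ∃ c, s =ᶠ[𝓝 t] fun _ => c := by
    rcases ht with h | h
    · exact ⟨0, by filter_upwards [Iio_mem_nhds h] with x hx using hs0 x (le_of_lt hx)⟩
    · exact ⟨1, by filter_upwards [Ioi_mem_nhds h] with x hx using hs1 x (le_of_lt hx)⟩
  obtain ⟨c, hc⟩ := this
  refine ⟨by simp [hc.deriv_eq], ?_⟩
  rw [hc.deriv.deriv_eq]
  simp

lemma logCutoff_kernel_bound {s : ℝ → ℝ} (hs0 : ∀ t ≤ 0, s t = 0)
    (hs1 : ∀ t, 1 ≤ t → s t = 1) (hs : ContDiff ℝ (⊤ : ℕ∞) s) {C : ℝ} (hC : 0 < C)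
    (hsC : ∀ t, |deriv s t| ≤ C ∧ |deriv (deriv s) t| ≤ C) {n : ℝ} (hn : 2 ≤ n) {ρ r d : ℝ}
    (hρ : 0 < ρ) (hρ4 : ρ < 1 / 4) (hnρ : Real.exp (-n) ≤ ρ / 2) (hr : 0 < r)
    (hd : |r - ρ| ≤ d) :
    |deriv (deriv (logCutoff s n)) (Real.log r)| * (4 * r ^ 2 * d)⁻¹ +
        |deriv (logCutoff s n) (Real.log r)| * (2 * r * d ^ 2)⁻¹ ≤
      (Iio 1).indicator (fun _ => 390 * C) r + C * (n⁻¹ ^ 2 * (ρ⁻¹ + 2 * ρ⁻¹ ^ 2)) *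
        (Icc (Real.exp (-(2 * n))) (Real.exp (-n))).indicator (fun r => (r ^ 2)⁻¹) r := by
  have hd0 : 0 ≤ d := (abs_nonneg _).trans hd
  have hn0 : 0 < n := by linarith
  have hsd := hs.differentiable (by simp)
  have hsdd := ((contDiff_infty_iff_deriv.1 hs).2).differentiable (by simp)
  rw [deriv_deriv_logCutoff hsd hsdd, deriv_logCutoff hsd]
  beta_reduce
  set t := Real.log r with ht
  have hrt : r = Real.exp t := (Real.exp_log hr).symm
  have hA : 0 ≤ (Iio (1 : ℝ)).indicator (fun _ => 390 * C) r :=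
    indicator_nonneg (fun _ _ => by positivity) _
  have hB : 0 ≤ C * (n⁻¹ ^ 2 * (ρ⁻¹ + 2 * ρ⁻¹ ^ 2)) *
        (Icc (Real.exp (-(2 * n))) (Real.exp (-n))).indicator (fun r => (r ^ 2)⁻¹) r :=
    mul_nonneg (by positivity) (indicator_nonneg (fun _ _ => by positivity) _)
  have hz := fun t => deriv_eq_zero_of_step hs0 hs1 (t := t)
  rcases le_or_gt t (-n) with hout | hin
  · have z2 := hz (2 + 2 * t) (Or.inl (by linarith))
    rw [z2.1, z2.2, mul_zero, mul_zero, sub_zero, sub_zero]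
    rcases lt_or_ge t (-(2 * n)) with hfar | hnear
    · have z1 := hz (2 + n⁻¹ * t) (Or.inl (by
        have : n⁻¹ * t < n⁻¹ * (-(2 * n)) := by gcongr
        have e : n⁻¹ * (-(2 * n)) = -2 := by field_simp
        linarith))
      rw [z1.1, z1.2]
      simpa using add_nonneg hA hB
    · have hr1 : r ≤ Real.exp (-n) := hrt ▸ Real.exp_le_exp.2 hout
      have hmem : r ∈ Icc (Real.exp (-(2 * n))) (Real.exp (-n)) :=
        ⟨hrt ▸ Real.exp_le_exp.2 hnear, hr1⟩
      have hrn : r ≤ n⁻¹ := by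
        refine hr1.trans ?_
        rw [Real.exp_neg]
        exact inv_anti₀ hn0 (by linarith [Real.add_one_le_exp n])
      have hdρ : ρ / 2 ≤ d := by
        have := neg_abs_le (r - ρ)
        linarith
      have hb1 : (4 * r ^ 2 * d)⁻¹ ≤ (r ^ 2)⁻¹ * ρ⁻¹ := by
        rw [← mul_inv]
        apply inv_anti₀ (by positivity)
        nlinarith [sq_pos_of_pos hr]
      have hb2 : (2 * r * d ^ 2)⁻¹ ≤ n⁻¹ * ((r ^ 2)⁻¹ * (2 * ρ⁻¹ ^ 2)) := by
        have h1 : (2 * r * d ^ 2)⁻¹ ≤ (2 * r * (ρ / 2) ^ 2)⁻¹ :=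
          inv_anti₀ (by positivity) (by gcongr)
        have h2 : (2 * r * (ρ / 2) ^ 2)⁻¹ = r * ((r ^ 2)⁻¹ * (2 * ρ⁻¹ ^ 2)) := by
          field_simp
        rw [h2] at h1
        exact h1.trans (by gcongr)
      rw [indicator_of_mem hmem, abs_mul, abs_mul, abs_of_pos (by positivity : 0 < n⁻¹ ^ 2),
        abs_of_pos (by positivity : 0 < n⁻¹)]
      calc _ ≤ n⁻¹ ^ 2 * C * ((r ^ 2)⁻¹ * ρ⁻¹) +
            n⁻¹ * C * (n⁻¹ * ((r ^ 2)⁻¹ * (2 * ρ⁻¹ ^ 2))) := by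
            gcongr
            · exact (hsC _).2
            · exact (hsC _).1
        _ = C * (n⁻¹ ^ 2 * (ρ⁻¹ + 2 * ρ⁻¹ ^ 2)) * (r ^ 2)⁻¹ := by ring
        _ ≤ _ := le_add_of_nonneg_left hA
  · have z1 := hz (2 + n⁻¹ * t) (Or.inr (by
      have : n⁻¹ * (-n) < n⁻¹ * t := by gcongr
      have e : n⁻¹ * (-n) = -1 := by field_simp
      linarith))
    rw [z1.1, z1.2, mul_zero, mul_zero, zero_sub, zero_sub, abs_neg, abs_neg]
    by_cases hmid : -1 ≤ t ∧ r < 1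
    · have hr3 : 36 / 100 ≤ r := by
        have h1 : Real.exp (-1) ≤ r := hrt ▸ Real.exp_le_exp.2 hmid.1
        have h2 : 36 / 100 ≤ Real.exp (-1) := by
          rw [Real.exp_neg, le_inv_comm₀ (by norm_num) (Real.exp_pos 1)]
          linarith [Real.exp_one_lt_d9]
        exact h2.trans h1
      have hd3 : 1 / 10 ≤ d := by
        have := le_abs_self (r - ρ)
        linarith
      have hb1 : (4 * r ^ 2 * d)⁻¹ ≤ (4 * (1 / 3) ^ 2 * (1 / 10))⁻¹ :=
        inv_anti₀ (by norm_num) (by gcongr; linarith)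
      have hb2 : (2 * r * d ^ 2)⁻¹ ≤ (2 * (1 / 3) * (1 / 10) ^ 2)⁻¹ :=
        inv_anti₀ (by norm_num) (by gcongr; linarith)
      rw [indicator_of_mem (mem_Iio.2 hmid.2), abs_mul, abs_mul, abs_of_pos (four_pos (α := ℝ)),
        abs_of_pos (two_pos (α := ℝ))]
      calc _ ≤ 4 * C * (4 * (1 / 3) ^ 2 * (1 / 10))⁻¹ +
            2 * C * (2 * (1 / 3) * (1 / 10) ^ 2)⁻¹ := by
            gcongr
            · exact (hsC _).2
            · exact (hsC _).1
        _ = 390 * C := by norm_num; ring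
        _ ≤ _ := le_add_of_nonneg_right hB
    · have z2 := hz (2 + 2 * t) (by
        rcases not_and_or.1 hmid with h | h
        · left; linarith [not_le.1 h]
        · right
          have : 0 ≤ t := Real.log_nonneg (not_lt.1 h)
          linarith)
      rw [z2.1, z2.2]
      simpa using add_nonneg hA hB

lemma integral_kernel_bound {n A B : ℝ} (hn : 0 ≤ n) :
    Integrable (fun z : ℂ => (Iio 1).indicator (fun _ => A) ‖z‖ + B *
        (Icc (Real.exp (-(2 * n))) (Real.exp (-n))).indicator (fun r => (r ^ 2)⁻¹) ‖z‖) ∧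
      ∫ z : ℂ, ((Iio 1).indicator (fun _ => A) ‖z‖ + B *
        (Icc (Real.exp (-(2 * n))) (Real.exp (-n))).indicator (fun r => (r ^ 2)⁻¹) ‖z‖) =
      Real.pi * A + B * (2 * Real.pi * n) := by
  have h := integral_annulus (Real.exp_pos (-(2 * n)))
    (Real.exp_le_exp.2 (by linarith : -(2 * n) ≤ -n))
  have heq : (fun z : ℂ => (Iio (1 : ℝ)).indicator (fun _ => A) ‖z‖) =
      (ball (0 : ℂ) 1).indicator fun _ => A := by
    ext z
    by_cases hz : ‖z‖ < 1 <;> simp [indicator, hz]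
  have hi : Integrable fun z : ℂ => (Iio (1 : ℝ)).indicator (fun _ => A) ‖z‖ := by
    rw [heq, integrable_indicator_iff measurableSet_ball]
    exact integrableOn_const (by simp [Complex.volume_ball])
  refine ⟨hi.add (h.1.const_mul B), ?_⟩
  rw [integral_add hi (h.1.const_mul B), integral_const_mul, h.2, heq,
    integral_indicator measurableSet_ball, setIntegral_const, ← Real.exp_sub, Real.log_exp]
  simp [Measure.real, Complex.volume_ball]
  ring_nf
  simp

lemma pi_mul_norm_wdz1_le {s : ℝ → ℝ} (hs0 : ∀ t ≤ 0, s t = 0)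
    (hs1 : ∀ t, 1 ≤ t → s t = 1) (hs : ContDiff ℝ (⊤ : ℕ∞) s)
    (hsI : ∀ t, s t ∈ Icc (0 : ℝ) 1) {C : ℝ} (hC : 0 < C)
    (hsC : ∀ t, |deriv s t| ≤ C ∧ |deriv (deriv s) t| ≤ C) {n : ℝ} (hn : 2 ≤ n)
    {γ K M : ℝ} {c : ℂ} (hc : 0 < ‖c‖) (hc4 : ‖c‖ < 1 / 4) (hnc : Real.exp (-n) ≤ ‖c‖ / 2)
    (hK : 0 < K) (hi : Integrable fun z : ℂ => ‖z‖ ^ γ * ‖z - c‖⁻¹) {w : ℂ → ℂ}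
    (hw : ContDiffOn ℝ (⊤ : ℕ∞) w (ball 0 1 \ {0})) (hM : 0 ≤ M)
    (hwM : ∀ z ∈ ball (0 : ℂ) 1 \ {0}, ‖w z‖ ≤ M)
    (hwK : ∀ z ∈ ball (0 : ℂ) 1 \ {0}, ‖wdzbar1 (wdz1 w) z‖ ≤ K * ‖z‖ ^ γ) :
    Real.pi * ‖wdz1 w c‖ ≤ K * (∫ z : ℂ, ‖z‖ ^ γ * ‖z - c‖⁻¹) +
      M * (Real.pi * (390 * C) +
        C * (n⁻¹ ^ 2 * (‖c‖⁻¹ + 2 * ‖c‖⁻¹ ^ 2)) * (2 * Real.pi * n)) := by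
  have hn0 : 0 < n := by linarith
  set f := logCutoff s n with hf
  have hfs : ContDiff ℝ (⊤ : ℕ∞) f :=
    (hs.comp (contDiff_const.add (contDiff_const.mul contDiff_id))).sub
      (hs.comp (contDiff_const.add (contDiff_const.mul contDiff_id)))
  have hf0 : ∀ t ≤ -(2 * n), f t = 0 := by
    intro t ht
    have h1 : n⁻¹ * t ≤ n⁻¹ * (-(2 * n)) := by gcongr
    have e : n⁻¹ * (-(2 * n)) = -2 := by field_simp
    rw [hf, logCutoff, hs0 _ (by linarith), hs0 _ (by linarith), sub_zero]
  have hf1 : ∀ t, -(1 / 2) ≤ t → f t = 0 := by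
    intro t ht
    have h1 : n⁻¹ * (-n) ≤ n⁻¹ * t := by gcongr; linarith
    have e : n⁻¹ * (-n) = -1 := by field_simp
    rw [hf, logCutoff, hs1 _ (by linarith), hs1 _ (by linarith), sub_self]
  have hfabs : ∀ t, |f t| ≤ 1 := by
    intro t
    have h1 := hsI (2 + n⁻¹ * t)
    have h2 := hsI (2 + 2 * t)
    rw [hf, logCutoff, abs_le]
    constructor <;> linarith [h1.1, h1.2, h2.1, h2.2]
  have hfc : ∀ t, -n ≤ t → t ≤ -1 → f t = 1 := by
    intro t ht ht1
    have h1 : n⁻¹ * (-n) ≤ n⁻¹ * t := by gcongr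
    have e : n⁻¹ * (-n) = -1 := by field_simp
    rw [hf, logCutoff, hs1 _ (by linarith), hs0 _ (by linarith), sub_zero]
  set ψ : ℂ → ℂ := fun z => (f (Real.log ‖z‖) : ℂ) with hψ
  have hψs : ContDiff ℝ (⊤ : ℕ∞) ψ := contDiff_comp_log_norm hfs (hf1 0 (by norm_num)) hf0
  have hts := tsupport_comp_log_norm_subset (by norm_num) hf0 hf1
  have hψc : HasCompactSupport ψ := by
    refine (isCompact_closedBall (0 : ℂ) (Real.exp (-(1 / 2)))).of_isClosed_subset
      (isClosed_tsupport _) (hts.trans fun z hz => ?_)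
    simpa using hz.2
  have hψU : tsupport ψ ⊆ ball (0 : ℂ) 1 \ {0} := by
    refine hts.trans fun z hz => ⟨?_, ?_⟩
    · have : Real.exp (-(1 / 2)) < 1 := Real.exp_lt_one_iff.2 (by norm_num)
      simpa using hz.2.trans_lt this
    · have := (Real.exp_pos _).trans_le hz.1
      simpa using this
  have hψ1 : ψ =ᶠ[𝓝 c] 1 := by
    have h1 : Real.exp (-n) < ‖c‖ := by linarith
    have h2 : ‖c‖ < Real.exp (-1) := by
      have : 1 / 4 ≤ Real.exp (-1) := by
        rw [Real.exp_neg, le_inv_comm₀ (by norm_num) (Real.exp_pos 1)]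
        linarith [Real.exp_one_lt_d9]
      linarith
    filter_upwards [continuous_norm.continuousAt.preimage_mem_nhds (Ioo_mem_nhds h1 h2)] with z hz
    have hz0 : 0 < ‖z‖ := (Real.exp_pos _).trans hz.1
    simp only [hψ, Pi.one_apply]
    rw [hfc _ ((Real.le_log_iff_exp_le hz0).2 hz.1.le) ((Real.log_le_iff_le_exp hz0).2 hz.2.le),
      ofReal_one]
  have hU : IsOpen (ball (0 : ℂ) 1 \ {0}) := isOpen_ball.sdiff isClosed_singleton
  have key := pi_mul_wdz1_eq hU hψs hψc hψU hψ1 hw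
  have b1 : ‖∫ z, (z - c)⁻¹ * (ψ z * wdzbar1 (wdz1 w) z)‖ ≤
      K * ∫ z : ℂ, ‖z‖ ^ γ * ‖z - c‖⁻¹ := by
    rw [← integral_const_mul]
    refine norm_integral_le_of_norm_le (hi.const_mul K) (ae_of_all _ fun z => ?_)
    by_cases hz : z ∈ tsupport ψ
    · rw [norm_mul, norm_mul, norm_inv, norm_real, Real.norm_eq_abs]
      calc _ ≤ ‖z - c‖⁻¹ * (1 * (K * ‖z‖ ^ γ)) := by
            gcongr
            · exact hfabs _
            · exact hwK z (hψU hz)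
        _ = _ := by ring
    · rw [image_eq_zero_of_notMem_tsupport hz]
      simp only [zero_mul, mul_zero, norm_zero]
      positivity
  obtain ⟨iD, eD⟩ := integral_kernel_bound (n := n) (A := 390 * C)
    (B := C * (n⁻¹ ^ 2 * (‖c‖⁻¹ + 2 * ‖c‖⁻¹ ^ 2))) hn0.le
  have b2 : ‖∫ z, wdz1 (fun z => (z - c)⁻¹ * wdzbar1 ψ z) z * w z‖ ≤
      M * (Real.pi * (390 * C) +
        C * (n⁻¹ ^ 2 * (‖c‖⁻¹ + 2 * ‖c‖⁻¹ ^ 2)) * (2 * Real.pi * n)) := by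
    rw [← eD, ← integral_const_mul]
    refine norm_integral_le_of_norm_le (iD.const_mul M) ?_
    filter_upwards [compl_mem_ae_iff.2 (measure_singleton (μ := volume) (0 : ℂ)),
      compl_mem_ae_iff.2 (measure_singleton (μ := volume) c)] with z hz hzc
    have hb := (norm_wdz1_inv_mul_wdzbar1_le hfs (c := c) hz hzc).trans
      (logCutoff_kernel_bound hs0 hs1 hs hC hsC hn hc hc4 hnc (norm_pos_iff.2 hz)
        (abs_norm_sub_norm_le z c))
    by_cases hzU : z ∈ ball (0 : ℂ) 1 \ {0}
    · rw [norm_mul, mul_comm]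
      exact mul_le_mul (hwM z hzU) hb (norm_nonneg _) hM
    · have h0 : (fun z => (z - c)⁻¹ * wdzbar1 ψ z) =ᶠ[𝓝 z] fun _ => 0 := by
        have : (tsupport ψ)ᶜ ∈ 𝓝 z :=
          (isClosed_tsupport ψ).isOpen_compl.mem_nhds fun h => hzU (hψU h)
        filter_upwards [this] with x hx
        rw [wdzbar1_eq_zero_of_notMem_tsupport hx, mul_zero]
      have h1 : wdz1 (fun z => (z - c)⁻¹ * wdzbar1 ψ z) z = 0 := by
        rw [wdz1, h0.fderiv_eq]
        simp
      rw [h1, zero_mul, norm_zero]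
      exact mul_nonneg hM ((norm_nonneg _).trans hb)
  calc Real.pi * ‖wdz1 w c‖ = ‖(Real.pi : ℂ) * wdz1 w c‖ := by
        rw [norm_mul, norm_real, Real.norm_of_nonneg Real.pi_pos.le]
    _ ≤ _ := by
        rw [key]
        refine (norm_add_le _ _).trans (add_le_add ?_ b2)
        rwa [norm_neg]

/-- gradient estimate from a potential-theoretic bound: if
∂²w/∂ζ∂ζ̄ = h on the punctured unit disk, with w bounded (by M) and |h(ζ)| ≤ K|ζ|^γ,
γ ∈ (−2,−1), then |∂w/∂ζ(ζ₀)| ≤ C|ζ₀|^{γ+1} on B_{1/4}(0)∖{0}, where C depends only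
on γ, K and the bound M for sup|w|. -/
theorem first_derivative_decay
    (γ : ℝ) (hγ : γ ∈ Set.Ioo (-2 : ℝ) (-1)) (K : ℝ) (hK : 0 < K)
    (M : ℝ) (hM : 0 ≤ M) :
    ∃ C > (0:ℝ), ∀ h w : ℂ → ℂ,
      ContinuousOn h (Metric.ball (0:ℂ) 1 \ {0}) →
      (∀ ζ ∈ Metric.ball (0:ℂ) 1 \ {0}, ‖h ζ‖ ≤ K * ‖ζ‖ ^ γ) →
      ContDiffOn ℝ (⊤ : ℕ∞) w (Metric.ball (0:ℂ) 1 \ {0}) →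
      (∀ ζ ∈ Metric.ball (0:ℂ) 1 \ {0}, ‖w ζ‖ ≤ M) →
      (∀ ζ ∈ Metric.ball (0:ℂ) 1 \ {0}, wdz1 (wdzbar1 w) ζ = h ζ) →
      ∀ ζ₀ : ℂ, 0 < ‖ζ₀‖ → ‖ζ₀‖ < 1/4 →
        ‖wdz1 w ζ₀‖ ≤ C * ‖ζ₀‖ ^ (γ + 1) := by
  obtain ⟨s, hs, hs0, hs1, hsI, C, hC, hsC⟩ := exists_smooth_step
  obtain ⟨C₁, hC₁, hker⟩ := exists_integral_rpow_mul_inv_le hγ.1 hγ.2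
  refine ⟨(K * C₁ + M * (Real.pi * (390 * C))) / Real.pi + 1, by positivity, ?_⟩
  intro h w _ hhK hw hwM hwh c hc hc4
  have hU : IsOpen (ball (0 : ℂ) 1 \ {0}) := isOpen_ball.sdiff isClosed_singleton
  have hwK : ∀ z ∈ ball (0 : ℂ) 1 \ {0}, ‖wdzbar1 (wdz1 w) z‖ ≤ K * ‖z‖ ^ γ := by
    intro z hz
    rw [wdzbar1_wdz1_comm (hw.contDiffAt (hU.mem_nhds hz)), hwh z hz]
    exact hhK z hz
  obtain ⟨hi, hI⟩ := hker c (norm_pos_iff.1 hc)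
  have hlim : Tendsto (fun n : ℝ => K * (∫ z : ℂ, ‖z‖ ^ γ * ‖z - c‖⁻¹) +
      M * (Real.pi * (390 * C) +
        C * (n⁻¹ ^ 2 * (‖c‖⁻¹ + 2 * ‖c‖⁻¹ ^ 2)) * (2 * Real.pi * n))) atTop
      (𝓝 (K * (∫ z : ℂ, ‖z‖ ^ γ * ‖z - c‖⁻¹) + M * (Real.pi * (390 * C) +
        C * (0 * (‖c‖⁻¹ + 2 * ‖c‖⁻¹ ^ 2)) * (2 * Real.pi)))) := by
    have h1 : Tendsto (fun n : ℝ => K * (∫ z : ℂ, ‖z‖ ^ γ * ‖z - c‖⁻¹) +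
      M * (Real.pi * (390 * C) +
        C * (n⁻¹ * (‖c‖⁻¹ + 2 * ‖c‖⁻¹ ^ 2)) * (2 * Real.pi))) atTop _ :=
      ((((tendsto_inv_atTop_zero.mul_const _).const_mul C).mul_const _).const_add _
        |>.const_mul M).const_add _
    refine h1.congr' ?_
    filter_upwards [eventually_gt_atTop 0] with n hn
    field_simp
  have hle := ge_of_tendsto hlim (b := Real.pi * ‖wdz1 w c‖) (by
    have hexp : Tendsto (fun n : ℝ => Real.exp (-n)) atTop (𝓝 0) :=
      Real.tendsto_exp_neg_atTop_nhds_zero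
    filter_upwards [eventually_ge_atTop 2, hexp.eventually_le_const (half_pos hc)] with n hn hnc
    exact pi_mul_norm_wdz1_le hs0 hs1 hs hsI hC hsC hn hc hc4 hnc hK hi hw hM hwM hwK)
  have hone : 1 ≤ ‖c‖ ^ (γ + 1) :=
    Real.one_le_rpow_of_pos_of_le_one_of_nonpos hc (by linarith) (by linarith [hγ.2])
  have hfin : Real.pi * ‖wdz1 w c‖ ≤
      (K * C₁ + M * (Real.pi * (390 * C))) * ‖c‖ ^ (γ + 1) := by
    calc _ ≤ K * (C₁ * ‖c‖ ^ (γ + 1)) + M * (Real.pi * (390 * C)) * 1 := by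
          have hIK := mul_le_mul_of_nonneg_left hI hK.le
          simp only [zero_mul, mul_zero, add_zero] at hle
          linarith
      _ ≤ K * (C₁ * ‖c‖ ^ (γ + 1)) + M * (Real.pi * (390 * C)) * ‖c‖ ^ (γ + 1) := by gcongr
      _ = _ := by ring
  calc ‖wdz1 w c‖ ≤ (K * C₁ + M * (Real.pi * (390 * C))) / Real.pi * ‖c‖ ^ (γ + 1) := by
        rw [div_mul_eq_mul_div, le_div_iff₀ Real.pi_pos]
        linarith
    _ ≤ _ := by
        gcongr
        linarith
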